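/- arXiv:2510.20371 — 4 statements merged into one kernel-verified Lean document; each statement's English description precedes it below -/
import Mathlib

section
/- Let T > 0, κ ≥ 0 and c_σ > 0. Let (w, {t_k}, {α_k}, σ) be a measure-time clock on [0,T]. Suppose E : [0,T] → ℝ is nonnegative, right-continuous, has a left limit E(t_k⁻) at each atom, is locally absolutely continuous on each interval between consecutive atoms (and before the first atom and after the last atom) with E′(τ) ≤ −2 κ c_σ w(τ) E(τ) for almost every τ there, and satisfies the multiplicative jump rule E(t_k) ≤ exp(−2 κ c_σ α_k) · E(t_k⁻) at every atom t_k. Then for all 0 ≤ s ≤ t ≤ T one has the canonical envelope E(t) ≤ E(s) · exp(−2 κ c_σ (σ(t) − σ(s))). -/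
open MeasureTheory Filter Set

/-- Postcomposition with a function that is Lipschitz on the range preserves absolute continuity. -/
theorem AbsolutelyContinuousOnInterval.lipschitzOnWith_comp {f φ : ℝ → ℝ} {a b : ℝ} {C : NNReal}
    (hφ : LipschitzOnWith C φ (f '' uIcc a b)) (hf : AbsolutelyContinuousOnInterval f a b) :
    AbsolutelyContinuousOnInterval (fun x ↦ φ (f x)) a b := by
  unfold AbsolutelyContinuousOnInterval at hf ⊢
  refine squeeze_zero' (Eventually.of_forall fun _ ↦ Finset.sum_nonneg fun _ _ ↦ dist_nonneg) ?_
    (by simpa using hf.const_mul (C : ℝ))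
  rw [eventually_inf_principal]
  filter_upwards with I hI
  rw [Finset.mul_sum]
  exact Finset.sum_le_sum fun i hi ↦ hφ.dist_le_mul _ (mem_image_of_mem _ (hI.1 i hi).1) _
    (mem_image_of_mem _ (hI.1 i hi).2)

/-- The exponential of an absolutely continuous function is absolutely continuous. -/
theorem AbsolutelyContinuousOnInterval.exp {f : ℝ → ℝ} {a b : ℝ}
    (hf : AbsolutelyContinuousOnInterval f a b) :
    AbsolutelyContinuousOnInterval (fun x ↦ Real.exp (f x)) a b := by
  obtain ⟨M, hM⟩ := hf.exists_bound
  obtain ⟨C, hC⟩ := (Real.contDiff_exp (n := 1)).contDiffOn.exists_lipschitzOnWith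
    (by decide) (convex_Icc (-M) M) isCompact_Icc
  refine lipschitzOnWith_comp (hC.mono ?_) hf
  rintro _ ⟨x, hx, rfl⟩
  exact abs_le.mp (hM x hx)

/-- An absolutely continuous function with almost everywhere nonpositive derivative decreases. -/
theorem AbsolutelyContinuousOnInterval.le_of_ae_deriv_nonpos {f : ℝ → ℝ} {a b : ℝ} (hab : a ≤ b)
    (hf : AbsolutelyContinuousOnInterval f a b) (hf' : ∀ᵐ x, x ∈ Icc a b → deriv f x ≤ 0) :
    f b ≤ f a := by
  have h : ∫ x in a..b, deriv f x ≤ 0 := by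
    rw [intervalIntegral.integral_of_le hab]
    refine integral_nonpos_of_ae ((ae_restrict_iff' measurableSet_Ioc).2 ?_)
    filter_upwards [hf'] with x hx hxab using hx (Ioc_subset_Icc_self hxab)
  rw [hf.integral_deriv_eq_sub] at h
  linarith

/-- **Grönwall's inequality** in Carathéodory form: if `E` is a primitive of `D` on `[a, b]` and
`D ≤ -K w E` almost everywhere, then `E b ≤ E a * exp (-K ∫_a^b w)`. -/
theorem le_mul_exp_integral_of_ae_le {a b K : ℝ} {E D w : ℝ → ℝ} (hab : a ≤ b)
    (hw : IntervalIntegrable w volume a b) (hD : IntervalIntegrable D volume a b)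
    (hE : ∀ x ∈ Icc a b, E x - E a = ∫ τ in a..x, D τ)
    (hdiss : ∀ᵐ τ, τ ∈ Icc a b → D τ ≤ -K * w τ * E τ) :
    E b ≤ E a * Real.exp (-K * ∫ τ in a..b, w τ) := by
  have ha : a ∈ uIcc a b := left_mem_uIcc
  have hf : AbsolutelyContinuousOnInterval (fun x ↦ E a + ∫ τ in a..x, D τ) a b :=
    (contDiff_const (c := E a)).contDiffOn.absolutelyContinuousOnInterval.fun_add
      (hD.absolutelyContinuousOnInterval_intervalIntegral ha)
  have hg : AbsolutelyContinuousOnInterval (fun x ↦ Real.exp (K * ∫ τ in a..x, w τ)) a b :=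
    ((hw.absolutelyContinuousOnInterval_intervalIntegral ha).const_mul K).exp
  have key := (hf.fun_mul hg).le_of_ae_deriv_nonpos hab (by
    filter_upwards [hD.ae_hasDerivAt_integral, hw.ae_hasDerivAt_integral, hdiss]
      with x hDx hwx hx hxab
    have hxu : x ∈ uIcc a b := by rwa [uIcc_of_le hab]
    rw [(((hDx hxu a ha).const_add (E a)).fun_mul ((hwx hxu a ha).const_mul K).exp).deriv,
      ← hE x hxab]
    have h := mul_nonneg (sub_nonneg.2 (hx hxab)) (Real.exp_pos (K * ∫ τ in a..x, w τ)).le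
    linear_combination h)
  simp only [← hE b (right_mem_Icc.2 hab), intervalIntegral.integral_same, mul_zero, Real.exp_zero,
    add_zero, mul_one, add_sub_cancel] at key
  rwa [neg_mul, Real.exp_neg, ← div_eq_mul_inv, le_div_iff₀ (Real.exp_pos _)]

/-- **Canonical envelope on a measure-time clock.**
A measure-time clock on `[0,T]` is given by a nonnegative locally integrable density `w`
together with finitely many atoms `0 < t 0 < ⋯ < t (n-1) ≤ T` with masses `α k > 0`;
the clock function is `σ x = ∫_0^x w + ∑_{t k ≤ x} α k`.
If `E` is nonnegative, right-continuous, has left limits `Eminus k` at the atoms,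
is locally absolutely continuous between consecutive atoms (encoded by the FTC identity
`E b - E a = ∫_a^b D` on atom-free subintervals, with `D` integrable and
`D τ ≤ -2κc_σ w τ E τ` a.e.), and satisfies the multiplicative jump rule
`E (t k) ≤ exp(-2κc_σ α k) · Eminus k`, then the canonical envelope
`E t ≤ E s · exp(-2κc_σ (σ t - σ s))` holds for all `0 ≤ s ≤ t ≤ T`. -/
theorem sigma_clock_canonical_envelope
    (T κ c : ℝ) (hT : 0 < T) (hκ : 0 ≤ κ) (hc : 0 < c)
    (w : ℝ → ℝ) (hw_nonneg : ∀ τ, 0 ≤ w τ) (hw_loc : LocallyIntegrable w volume)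
    (n : ℕ) (t : Fin n → ℝ) (α : Fin n → ℝ)
    (ht_mono : StrictMono t) (ht_pos : ∀ k, 0 < t k) (ht_le : ∀ k, t k ≤ T)
    (hα_pos : ∀ k, 0 < α k)
    (σ : ℝ → ℝ)
    (hσ : ∀ x, σ x = (∫ τ in (0:ℝ)..x, w τ) + ∑ k : Fin n, (if t k ≤ x then α k else 0))
    (E D : ℝ → ℝ) (Eminus : Fin n → ℝ)
    (hE_nonneg : ∀ x ∈ Icc (0:ℝ) T, 0 ≤ E x)
    (hE_rc : ∀ x ∈ Ico (0:ℝ) T, ContinuousWithinAt E (Ici x) x)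
    (hE_left : ∀ k, Tendsto E (nhdsWithin (t k) (Iio (t k))) (nhds (Eminus k)))
    (hD_int : IntegrableOn D (Icc (0:ℝ) T) volume)
    (hAC : ∀ a b : ℝ, 0 ≤ a → a ≤ b → b ≤ T → (∀ k, t k ∉ Ioc a b) →
      E b - E a = ∫ τ in a..b, D τ)
    (hdiss : ∀ᵐ τ ∂(volume.restrict (Icc (0:ℝ) T)), D τ ≤ -(2 * κ * c) * w τ * E τ)
    (hjump : ∀ k, E (t k) ≤ Real.exp (-(2 * κ * c) * α k) * Eminus k) :
    ∀ s u : ℝ, 0 ≤ s → s ≤ u → u ≤ T →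
      E u ≤ E s * Real.exp (-(2 * κ * c) * (σ u - σ s)) := by
  set K := 2 * κ * c
  have hwi : ∀ a b, IntervalIntegrable w volume a b := fun a b ↦
    (hw_loc.integrableOn_isCompact isCompact_uIcc).intervalIntegrable
  have hσ_sub : ∀ a b, a ≤ b → σ b - σ a = (∫ τ in a..b, w τ) +
      ∑ k, (if t k ∈ Ioc a b then α k else 0) := by
    intro a b hab
    rw [hσ, hσ, add_sub_add_comm, intervalIntegral.integral_interval_sub_left (hwi _ _) (hwi _ _),
      ← Finset.sum_sub_distrib]
    congr 1
    refine Finset.sum_congr rfl fun k _ ↦ ?_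
    by_cases h1 : t k ≤ a
    · simp [h1, h1.trans hab]
    · simp [h1, not_le.1 h1]
  have hgap : ∀ a b, 0 ≤ a → a ≤ b → b ≤ T → (∀ k, t k ∉ Ioc a b) →
      E b ≤ E a * Real.exp (-K * ∫ τ in a..b, w τ) := by
    intro a b ha hab hb hno
    refine le_mul_exp_integral_of_ae_le hab (hwi a b) ?_ (fun x hx ↦ hAC a x ha hx.1
      (hx.2.trans hb) fun k hk ↦ hno k ⟨hk.1, hk.2.trans hx.2⟩) ?_
    · exact (intervalIntegrable_iff_integrableOn_Icc_of_le hab).2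
        (hD_int.mono_set (Icc_subset_Icc ha hb))
    · filter_upwards [(ae_restrict_iff' measurableSet_Icc).1 hdiss] with τ hτ hmem
      exact hτ ⟨ha.trans hmem.1, hmem.2.trans hb⟩
  have hatom : ∀ a k, 0 ≤ a → a < t k → (∀ j, t j ∉ Ioo a (t k)) →
      E (t k) ≤ E a * Real.exp (-K * (σ (t k) - σ a)) := by
    intro a k ha hak hno
    have hlim : Eminus k ≤ E a * Real.exp (-K * ∫ τ in a..t k, w τ) := by
      have hcont : Continuous fun x ↦ E a * Real.exp (-K * ∫ τ in a..x, w τ) := by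
        have := intervalIntegral.continuous_primitive hwi a
        fun_prop
      refine le_of_tendsto_of_tendsto (hE_left k) hcont.continuousAt.continuousWithinAt ?_
      filter_upwards [Ioo_mem_nhdsLT hak] with x hx
      exact hgap a x ha hx.1.le (hx.2.le.trans (ht_le k))
        fun j hj ↦ hno j ⟨hj.1, hj.2.trans_lt hx.2⟩
    have hsum : ∑ j, (if t j ∈ Ioc a (t k) then α j else 0) = α k := by
      rw [Finset.sum_eq_single k]
      · simp [hak]
      · intro j _ hjk
        rw [if_neg]
        exact fun hj ↦ hno j ⟨hj.1, lt_of_le_of_ne hj.2 (ht_mono.injective.ne hjk)⟩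
      · simp
    calc E (t k) ≤ Real.exp (-K * α k) * (E a * Real.exp (-K * ∫ τ in a..t k, w τ)) :=
          (hjump k).trans (mul_le_mul_of_nonneg_left hlim (Real.exp_pos _).le)
      _ = E a * Real.exp (-K * (σ (t k) - σ a)) := by
          rw [hσ_sub _ _ hak.le, hsum, mul_add, Real.exp_add]
          ring
  intro s u hs hsu hu
  induction hN : (Finset.univ.filter fun k ↦ t k ∈ Ioc s u).card using Nat.strong_induction_on
    generalizing s with
  | _ N ih =>
    rcases (Finset.univ.filter fun k ↦ t k ∈ Ioc s u).eq_empty_or_nonempty with hemp | hne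
    · have hno : ∀ k, t k ∉ Ioc s u := fun k ↦ Finset.filter_eq_empty_iff.1 hemp (Finset.mem_univ k)
      simpa [hσ_sub s u hsu, -mem_Ioc, hno] using hgap s u hs hsu hu hno
    · obtain ⟨k, hk, hmin⟩ := Finset.exists_min_image _ t hne
      simp only [Finset.mem_filter, Finset.mem_univ, true_and] at hk hmin
      have hle : E u ≤ E (t k) * Real.exp (-K * (σ u - σ (t k))) := by
        refine ih _ ?_ (t k) (ht_pos k).le hk.2 rfl
        rw [← hN]
        refine Finset.card_lt_card
          (Finset.ssubset_iff_of_subset ?_ |>.2 ⟨k, by simpa using hk, by simp⟩)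
        exact Finset.monotone_filter_right _ fun j _ hj ↦ ⟨hk.1.trans hj.1, hj.2⟩
      calc E u ≤ E (t k) * Real.exp (-K * (σ u - σ (t k))) := hle
        _ ≤ E s * Real.exp (-K * (σ (t k) - σ s)) * Real.exp (-K * (σ u - σ (t k))) :=
            mul_le_mul_of_nonneg_right (hatom s k hs hk.1 fun j hj ↦
              (hmin j ⟨hj.1, hj.2.le.trans hk.2⟩).not_gt hj.2) (Real.exp_pos _).le
        _ = E s * Real.exp (-K * (σ u - σ s)) := by
            rw [mul_assoc, ← Real.exp_add]
            ring_nf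
end

section
/- Let T > 0 and κ ≥ 0. Let w : ℝ → ℝ be a nonnegative locally integrable density and let 0 < t_1 < ⋯ < t_n ≤ T be finitely many atoms with jump factors ρ_k ∈ (0,1]. Suppose E : [0,T] → ℝ is nonnegative, right-continuous, has a left limit E(t_k⁻) at each atom, is locally absolutely continuous on each interval between consecutive atoms (and before the first atom and after the last atom) with E′(τ) ≤ −2 κ w(τ) E(τ) for almost every τ there, and satisfies E(t_k) ≤ ρ_k · E(t_k⁻) at every atom t_k. Then for all 0 ≤ s ≤ t ≤ T, E(t) ≤ exp(−2 κ ∫_s^t w(τ) dτ) · (∏_{t_k ∈ (s,t]} ρ_k) · E(s). -/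
open MeasureTheory Filter Set

/-- Post-composition with a Lipschitz function preserves absolute continuity. -/
theorem LipschitzOnWith.comp_absolutelyContinuousOnInterval {f g : ℝ → ℝ} {a b : ℝ} {K : NNReal}
    (hg : LipschitzOnWith K g (f '' uIcc a b)) (hf : AbsolutelyContinuousOnInterval f a b) :
    AbsolutelyContinuousOnInterval (fun x ↦ g (f x)) a b := by
  have hlim := Tendsto.const_mul (K : ℝ) hf
  rw [mul_zero] at hlim
  refine squeeze_zero' ?_ ?_ hlim
  · filter_upwards with I
    exact Finset.sum_nonneg fun _ _ ↦ dist_nonneg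
  · filter_upwards [mem_inf_of_right (mem_principal_self _)] with I hI
    rw [Finset.mul_sum]
    refine Finset.sum_le_sum fun i hi ↦ ?_
    have h := hI.1 i hi
    exact hg.dist_le_mul _ (mem_image_of_mem f h.1) _ (mem_image_of_mem f h.2)

/-- Grönwall's inequality with an integrable rate, for an absolutely continuous function given
as the primitive of an integrable function `D`. -/
theorem le_exp_neg_integral_mul_of_ae_le {a b : ℝ} (hab : a ≤ b) {v D f : ℝ → ℝ}
    (hv : IntervalIntegrable v volume a b) (hD : IntervalIntegrable D volume a b)
    (hf : ∀ x ∈ Icc a b, f x - f a = ∫ τ in a..x, D τ)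
    (hle : ∀ᵐ x, x ∈ Icc a b → D x ≤ -(v x * f x)) :
    f b ≤ Real.exp (-∫ τ in a..b, v τ) * f a := by
  set V : ℝ → ℝ := fun x ↦ ∫ τ in a..x, v τ with hV
  set F : ℝ → ℝ := fun x ↦ ∫ τ in a..x, D τ with hF
  have hVac : AbsolutelyContinuousOnInterval V a b :=
    hv.absolutelyContinuousOnInterval_intervalIntegral left_mem_uIcc
  have hFac : AbsolutelyContinuousOnInterval F a b :=
    hD.absolutelyContinuousOnInterval_intervalIntegral left_mem_uIcc
  have hcac : AbsolutelyContinuousOnInterval (fun _ : ℝ ↦ f a) a b :=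
    (LipschitzWith.const (f a)).lipschitzOnWith.absolutelyContinuousOnInterval
  have hint := (hVac.exp.fun_mul (hFac.fun_add hcac)).integral_deriv_eq_sub
  have hnonpos : ∫ x in a..b, deriv (fun x ↦ Real.exp (V x) * (F x + f a)) x ≤ 0 := by
    have hae : ∀ᵐ x, x ∈ Icc a b →
        deriv (fun x ↦ Real.exp (V x) * (F x + f a)) x ≤ 0 := by
      filter_upwards [hv.ae_hasDerivAt_integral, hD.ae_hasDerivAt_integral, hle]
        with x hvx hDx hlex hx
      have hx' : x ∈ uIcc a b := Icc_subset_uIcc hx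
      have hd := (hvx hx' a left_mem_uIcc).exp.mul ((hDx hx' a left_mem_uIcc).add_const (f a))
      have hd' : deriv (fun x ↦ Real.exp (V x) * (F x + f a)) x = _ := hd.deriv
      rw [hd', ← hf x hx]
      have := mul_le_mul_of_nonneg_left (hlex hx) (Real.exp_pos (V x)).le
      simp only [hV] at this ⊢
      linarith
    rw [intervalIntegral.integral_of_le hab]
    refine setIntegral_nonpos_ae measurableSet_Ioc ?_
    filter_upwards [hae] with x hx hx'
    exact hx (Ioc_subset_Icc_self hx')
  rw [hint] at hnonpos
  have hFb : F b + f a = f b := by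
    have := hf b (right_mem_Icc.2 hab)
    simp only [hF]
    linarith
  have hFa : F a = 0 := by simp [hF]
  have hVa : V a = 0 := by simp [hV]
  simp only [hFb, hFa, hVa, Real.exp_zero, one_mul, zero_add] at hnonpos
  rw [Real.exp_neg, inv_mul_eq_div, le_div_iff₀ (Real.exp_pos _)]
  linarith

/-- **Product–exponential master decay.**
Given a nonnegative locally integrable density `w`, finitely many atoms
`0 < t 0 < ⋯ < t (n-1) ≤ T` with jump factors `ρ k ∈ (0,1]`, and an energy `E`
that is nonnegative, right-continuous, has left limits `Eminus k` at the atoms,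
is locally absolutely continuous between consecutive atoms (encoded via the FTC
identity with an integrable a.e. derivative `D` satisfying `D τ ≤ -2κ w τ E τ`),
and satisfies `E (t k) ≤ ρ k · Eminus k` at every atom, then
`E t ≤ exp(-2κ ∫_s^t w) · (∏_{t k ∈ (s,t]} ρ k) · E s` for all `0 ≤ s ≤ t ≤ T`. -/
theorem product_exponential_master_decay
    (T κ : ℝ) (hT : 0 < T) (hκ : 0 ≤ κ)
    (w : ℝ → ℝ) (hw_nonneg : ∀ τ, 0 ≤ w τ) (hw_loc : LocallyIntegrable w volume)
    (n : ℕ) (t : Fin n → ℝ) (ρ : Fin n → ℝ)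
    (ht_mono : StrictMono t) (ht_pos : ∀ k, 0 < t k) (ht_le : ∀ k, t k ≤ T)
    (hρ : ∀ k, ρ k ∈ Ioc (0:ℝ) 1)
    (E D : ℝ → ℝ) (Eminus : Fin n → ℝ)
    (hE_nonneg : ∀ x ∈ Icc (0:ℝ) T, 0 ≤ E x)
    (hE_rc : ∀ x ∈ Ico (0:ℝ) T, ContinuousWithinAt E (Ici x) x)
    (hE_left : ∀ k, Tendsto E (nhdsWithin (t k) (Iio (t k))) (nhds (Eminus k)))
    (hD_int : IntegrableOn D (Icc (0:ℝ) T) volume)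
    (hAC : ∀ a b : ℝ, 0 ≤ a → a ≤ b → b ≤ T → (∀ k, t k ∉ Ioc a b) →
      E b - E a = ∫ τ in a..b, D τ)
    (hdiss : ∀ᵐ τ ∂(volume.restrict (Icc (0:ℝ) T)), D τ ≤ -(2 * κ) * w τ * E τ)
    (hjump : ∀ k, E (t k) ≤ ρ k * Eminus k) :
    ∀ s u : ℝ, 0 ≤ s → s ≤ u → u ≤ T →
      E u ≤ Real.exp (-(2 * κ) * ∫ τ in s..u, w τ) *
        (∏ k : Fin n, (if t k ∈ Ioc s u then ρ k else 1)) * E s := by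
  have hwi (a b : ℝ) : IntervalIntegrable w volume a b :=
    intervalIntegrable_iff.2
      ((hw_loc.integrableOn_isCompact isCompact_uIcc).mono_set uIoc_subset_uIcc)
  have hfree (a b : ℝ) (ha : 0 ≤ a) (hab : a ≤ b) (hb : b ≤ T) (hk : ∀ k, t k ∉ Ioc a b) :
      E b ≤ Real.exp (-(2 * κ) * ∫ τ in a..b, w τ) * E a := by
    have h := le_exp_neg_integral_mul_of_ae_le (f := E) hab ((hwi a b).const_mul (2 * κ))
      ((intervalIntegrable_iff_integrableOn_Icc_of_le hab).2
        (hD_int.mono_set (Icc_subset_Icc ha hb)))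
      (fun x hx ↦ hAC a x ha hx.1 (hx.2.trans hb) fun k hkx ↦ hk k ⟨hkx.1, hkx.2.trans hx.2⟩) ?_
    · rwa [intervalIntegral.integral_const_mul, ← neg_mul] at h
    · filter_upwards [(ae_restrict_iff' measurableSet_Icc).1 hdiss] with x hx hxab
      have := hx (Icc_subset_Icc ha hb hxab)
      linarith
  have hatom (s : ℝ) (hs : 0 ≤ s) (k : Fin n) (hsk : s < t k) (hk : ∀ j, t j ∉ Ioo s (t k)) :
      E (t k) ≤ Real.exp (-(2 * κ) * ∫ τ in s..t k, w τ) * ρ k * E s := by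
    have hcont : Continuous fun x ↦ ∫ τ in s..x, w τ :=
      intervalIntegral.continuous_primitive hwi s
    have hlim : Tendsto (fun x ↦ Real.exp (-(2 * κ) * ∫ τ in s..x, w τ) * E s)
        (nhdsWithin (t k) (Iio (t k)))
        (nhds (Real.exp (-(2 * κ) * ∫ τ in s..t k, w τ) * E s)) :=
      ((Real.continuous_exp.comp (hcont.const_mul _)).mul_const _).continuousWithinAt
    have hminus : Eminus k ≤ Real.exp (-(2 * κ) * ∫ τ in s..t k, w τ) * E s := by
      refine le_of_tendsto_of_tendsto (hE_left k) hlim ?_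
      filter_upwards [Ioo_mem_nhdsLT hsk] with x hx
      exact hfree s x hs hx.1.le (hx.2.le.trans (ht_le k)) fun j hj ↦
        hk j ⟨hj.1, hj.2.trans_lt hx.2⟩
    calc E (t k) ≤ ρ k * Eminus k := hjump k
      _ ≤ ρ k * (Real.exp (-(2 * κ) * ∫ τ in s..t k, w τ) * E s) :=
        mul_le_mul_of_nonneg_left hminus (hρ k).1.le
      _ = _ := by ring
  intro s u hs hsu huT
  induction hm : (Finset.univ.filter fun k ↦ t k ∈ Ioc s u).card using Nat.strong_induction_on
    generalizing s with
  | _ m ih =>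
    by_cases hne : (Finset.univ.filter fun k ↦ t k ∈ Ioc s u).Nonempty
    · obtain ⟨k, hk, hmin⟩ := Finset.exists_min_image _ t hne
      simp only [Finset.mem_filter, Finset.mem_univ, true_and] at hk hmin
      have hstep := hatom s hs k hk.1 fun j hj ↦
        (hmin j ⟨hj.1, hj.2.le.trans hk.2⟩).not_gt hj.2
      have hcard : (Finset.univ.filter fun j ↦ t j ∈ Ioc (t k) u).card < m := by
        rw [← hm]
        refine Finset.card_lt_card (Finset.ssubset_iff_of_subset ?_ |>.2 ⟨k, ?_, ?_⟩)
        · intro j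
          simp only [Finset.mem_filter, Finset.mem_univ, true_and]
          exact fun hj ↦ ⟨hk.1.trans hj.1, hj.2⟩
        · simpa using hk
        · simp
      have hrest := ih _ hcard (t k) (ht_pos k).le hk.2 rfl
      have hprod : (∏ j : Fin n, if t j ∈ Ioc s u then ρ j else 1) =
          ρ k * ∏ j : Fin n, if t j ∈ Ioc (t k) u then ρ j else 1 := by
        rw [← Fintype.prod_ite_eq' k ρ, ← Finset.prod_mul_distrib]
        refine Finset.prod_congr rfl fun j _ ↦ ?_
        rcases eq_or_ne j k with rfl | hjk
        · simp [hk.1, hk.2]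
        · have hiff : t j ∈ Ioc s u ↔ t j ∈ Ioc (t k) u :=
            ⟨fun hj ↦ ⟨(hmin j hj).lt_of_ne fun h ↦ hjk (ht_mono.injective h).symm, hj.2⟩,
              fun hj ↦ ⟨hk.1.trans hj.1, hj.2⟩⟩
          simp [hjk, hiff]
      have hnonneg : 0 ≤ ∏ j : Fin n, if t j ∈ Ioc (t k) u then ρ j else 1 :=
        Finset.prod_nonneg fun j _ ↦ by
          split_ifs
          exacts [(hρ j).1.le, zero_le_one]
      rw [hprod, ← intervalIntegral.integral_add_adjacent_intervals (hwi s (t k)) (hwi (t k) u),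
        mul_add, Real.exp_add]
      refine hrest.trans ((mul_le_mul_of_nonneg_left hstep
        (mul_nonneg (Real.exp_pos _).le hnonneg)).trans_eq ?_)
      ring
    · have hk : ∀ k, t k ∉ Ioc s u := fun k hk ↦ hne ⟨k, by simpa using hk⟩
      simpa only [hk, if_false, Finset.prod_const_one, mul_one] using hfree s u hs hsu huT hk
end

section
/- Let κ ≥ 0, let H be a real symmetric positive definite n×n matrix, and let S, K be real n×n matrices with Sᵀ H + H S ≼ −2 κ H (i.e. −2κH − SᵀH − HS is positive semidefinite) and Kᵀ H + H K = 0. Set A := S + K. Let Δσ ≥ 0 and suppose u, u⁺ ∈ ℝⁿ satisfy the implicit midpoint relation u⁺ = u + Δσ · A ((u⁺ + u)/2). Then, with m := (u⁺ + u)/2 and E(v) := (1/2) vᵀ H v, one has E(u⁺) − E(u) ≤ −2 κ Δσ · (1/2) mᵀ H m ≤ 0. -/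
open Matrix

namespace Matrix

theorem IsSymm.dotProduct_mulVec_comm {ι R : Type*} [Fintype ι] [CommSemiring R]
    {H : Matrix ι ι R} (hH : H.IsSymm) (x y : ι → R) :
    x ⬝ᵥ H *ᵥ y = y ⬝ᵥ H *ᵥ x := by
  rw [dotProduct_mulVec, ← mulVec_transpose, hH.eq, dotProduct_comm]

/-- The quadratic form of `Mᵀ H + H M` is twice that of `H M`. -/
theorem IsSymm.dotProduct_transpose_mul_add_mul_mulVec {ι R : Type*} [Fintype ι] [CommSemiring R]
    {H : Matrix ι ι R} (hH : H.IsSymm) (M : Matrix ι ι R) (x : ι → R) :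
    x ⬝ᵥ (Mᵀ * H + H * M) *ᵥ x = 2 * (x ⬝ᵥ H *ᵥ (M *ᵥ x)) := by
  rw [add_mulVec, dotProduct_add, ← mulVec_mulVec, ← mulVec_mulVec, dotProduct_mulVec x Mᵀ,
    vecMul_transpose, hH.dotProduct_mulVec_comm (M *ᵥ x) x, two_mul]

/-- The energy difference is the `H`-pairing of the midpoint with the increment. -/
theorem IsSymm.half_quadratic_sub {ι : Type*} [Fintype ι]
    {H : Matrix ι ι ℝ} (hH : H.IsSymm) (u v : ι → ℝ) :
    (1 / 2) * (v ⬝ᵥ H *ᵥ v) - (1 / 2) * (u ⬝ᵥ H *ᵥ u) =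
      ((2 : ℝ)⁻¹ • (v + u)) ⬝ᵥ H *ᵥ (v - u) := by
  simp only [smul_dotProduct, add_dotProduct, mulVec_sub, dotProduct_sub, smul_eq_mul]
  rw [hH.dotProduct_mulVec_comm u v]
  ring

end Matrix

/-- **Algebraic stability of the implicit midpoint step.**
`H` is symmetric positive definite, `S` satisfies the Löwner bound
`Sᵀ H + H S ≼ -2κ H`, and `K` is `H`-skew (`Kᵀ H + H K = 0`). For `A = S + K`
and the implicit midpoint relation `u⁺ = u + Δσ · A m` with midpoint
`m = (u⁺ + u)/2`, the energy `E v = (1/2) vᵀ H v` satisfies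
`E u⁺ - E u ≤ -2κ Δσ · (1/2) mᵀ H m ≤ 0`. -/
theorem implicit_midpoint_algebraic_stability
    (κ : ℝ) (hκ : 0 ≤ κ) (n : ℕ)
    (H S K : Matrix (Fin n) (Fin n) ℝ)
    (hH_symm : H.IsSymm) (hH_pd : H.PosDef)
    (hS : (-(2 * κ) • H - (S.transpose * H + H * S)).PosSemidef)
    (hK : K.transpose * H + H * K = 0)
    (Δσ : ℝ) (hΔσ : 0 ≤ Δσ)
    (u u' : Fin n → ℝ)
    (hmid : u' = u + Δσ • ((S + K).mulVec ((2:ℝ)⁻¹ • (u' + u)))) :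
    ((1/2) * (u' ⬝ᵥ H.mulVec u') - (1/2) * (u ⬝ᵥ H.mulVec u)
        ≤ -(2 * κ * Δσ) *
          ((1/2) * (((2:ℝ)⁻¹ • (u' + u)) ⬝ᵥ H.mulVec ((2:ℝ)⁻¹ • (u' + u))))) ∧
    (-(2 * κ * Δσ) *
        ((1/2) * (((2:ℝ)⁻¹ • (u' + u)) ⬝ᵥ H.mulVec ((2:ℝ)⁻¹ • (u' + u)))) ≤ 0) := by
  set m : Fin n → ℝ := (2 : ℝ)⁻¹ • (u' + u) with hm
  have h_inc : u' - u = Δσ • ((S + K) *ᵥ m) := sub_eq_iff_eq_add'.mpr hmid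
  have h_nonneg : 0 ≤ m ⬝ᵥ H *ᵥ m := by
    simpa using hH_pd.posSemidef.dotProduct_mulVec_nonneg m
  have h_skew : m ⬝ᵥ H *ᵥ (K *ᵥ m) = 0 := by
    have h := hH_symm.dotProduct_transpose_mul_add_mul_mulVec K m
    rw [hK, zero_mulVec, dotProduct_zero] at h
    linarith
  have h_diss : m ⬝ᵥ H *ᵥ (S *ᵥ m) ≤ -κ * (m ⬝ᵥ H *ᵥ m) := by
    have h := hS.dotProduct_mulVec_nonneg m
    rw [star_trivial, sub_mulVec, dotProduct_sub,
      hH_symm.dotProduct_transpose_mul_add_mul_mulVec, smul_mulVec, dotProduct_smul,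
      smul_eq_mul] at h
    linarith
  constructor
  · rw [hH_symm.half_quadratic_sub, ← hm, h_inc, mulVec_smul, dotProduct_smul, smul_eq_mul,
      add_mulVec, mulVec_add, dotProduct_add, h_skew, add_zero]
    linarith [mul_le_mul_of_nonneg_left h_diss hΔσ]
  · rw [neg_mul, neg_nonpos]
    positivity
end

section
/- Let H be a real symmetric positive definite n×n matrix and let P be a real n×n matrix that is an H-orthogonal projector, i.e. P P = P and H P = Pᵀ H. Let θ ∈ [0,1]. Then the matrix I + θ P is invertible and the Cayley-type update J := (I + θ P)⁻¹ (I − θ P) satisfies Jᵀ H J ≼ H, i.e. H − Jᵀ H J is positive semidefinite; in particular J is nonexpansive for the energy E(v) = (1/2) vᵀ H v. -/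
open Matrix

/-- The resolvent of an idempotent: `1 + θ P` has inverse `1 - (θ / (1 + θ)) P`. -/
theorem IsIdempotentElem.one_add_smul_mul_one_sub_smul {K A : Type*} [Field K] [Ring A]
    [Algebra K A] {P : A} (hP : IsIdempotentElem P) {θ : K} (hθ : 1 + θ ≠ 0) :
    (1 + θ • P) * (1 - (θ / (1 + θ)) • P) = 1 := by
  have hP' : P * P = P := hP
  simp only [add_mul, mul_sub, one_mul, mul_one, smul_mul_smul_comm, hP']
  match_scalars
  · ring
  · field_simp
    ring

/-- The Cayley transform of an idempotent `P` is `1 - (2θ / (1 + θ)) P`. -/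
theorem IsIdempotentElem.one_sub_smul_mul_one_sub_smul {K A : Type*} [Field K] [Ring A]
    [Algebra K A] {P : A} (hP : IsIdempotentElem P) {θ : K} (hθ : 1 + θ ≠ 0) :
    (1 - (θ / (1 + θ)) • P) * (1 - θ • P) = 1 - (2 * θ / (1 + θ)) • P := by
  have hP' : P * P = P := hP
  simp only [sub_mul, mul_sub, one_mul, mul_one, smul_mul_smul_comm, hP']
  match_scalars
  · ring
  · field_simp
    ring

/-- The energy defect of `1 - c P` for an `H`-orthogonal projector `P`. -/
theorem Matrix.sub_transpose_mul_mul_one_sub_smul {ι R : Type*} [Fintype ι] [DecidableEq ι]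
    [CommRing R] {H P : Matrix ι ι R} (hP : P * P = P) (hHP : H * P = Pᵀ * H) (c : R) :
    H - (1 - c • P)ᵀ * H * (1 - c • P) = (2 * c - c ^ 2) • (Pᵀ * H * P) := by
  simp only [transpose_sub, transpose_one, transpose_smul, sub_mul, mul_sub, one_mul, mul_one,
    Matrix.smul_mul, Matrix.mul_smul, ← hHP]
  rw [Matrix.mul_assoc, hP]
  module

/-- **Cayley-type tick map is nonexpansive for the `H`-energy.**
Let `H` be symmetric positive definite and `P` an `H`-orthogonal projector
(`P P = P` and `H P = Pᵀ H`), `θ ∈ [0,1]`. Then `I + θ P` is invertible and the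
Cayley-type update `J = (I + θP)⁻¹ (I - θP)` satisfies `Jᵀ H J ≼ H`, i.e.
`H - Jᵀ H J` is positive semidefinite; in particular `J` is nonexpansive for the
energy `E v = (1/2) vᵀ H v`. -/
theorem cayley_tick_map_nonexpansive
    (n : ℕ) (H P : Matrix (Fin n) (Fin n) ℝ)
    (hH_symm : H.IsSymm) (hH_pd : H.PosDef)
    (hP_idem : P * P = P) (hP_adj : H * P = P.transpose * H)
    (θ : ℝ) (hθ : θ ∈ Set.Icc (0:ℝ) 1) :
    IsUnit (1 + θ • P) ∧
      (H - ((1 + θ • P)⁻¹ * (1 - θ • P)).transpose * H *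
        ((1 + θ • P)⁻¹ * (1 - θ • P))).PosSemidef := by
  obtain ⟨hθ0, -⟩ := hθ
  have hpos : 0 < 1 + θ := by linarith
  have hP : IsIdempotentElem P := hP_idem
  have hinv := hP.one_add_smul_mul_one_sub_smul hpos.ne'
  refine ⟨IsUnit.of_mul_eq_one _ hinv, ?_⟩
  rw [Matrix.inv_eq_right_inv hinv, hP.one_sub_smul_mul_one_sub_smul hpos.ne',
    Matrix.sub_transpose_mul_mul_one_sub_smul hP_idem hP_adj]
  have hcoef : 2 * (2 * θ / (1 + θ)) - (2 * θ / (1 + θ)) ^ 2 = 4 * θ / (1 + θ) ^ 2 := by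
    field_simp
    ring
  rw [hcoef, ← conjTranspose_eq_transpose_of_trivial]
  exact (hH_pd.posSemidef.conjTranspose_mul_mul_same P).smul (by positivity)
end
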